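/- Let L : ℝ^m → ℝ be differentiable and β-smooth (β > 0), let w ∈ ℝ^m, θ > 0, η > 0, γ > 0, δ ∈ (0, 1). Let g : Ω → ℝ^m be an integrable random vector on a probability space (Ω, F, P) with E[g] = ∇L(w) and ‖g − ∇L(w)‖ ≤ θ almost surely, and let w' = w − h(g)·g where h(g) = η·min{1, max{δ, γ/‖g‖}} (and h(g) = η when g = 0). Then E[L(w')] ≤ L(w) + (η(1 − δ)θ + βη²θ)·‖∇L(w)‖ − (ηδ − βη²/2)·‖∇L(w)‖² + βη²θ²/2. -/

import Mathlib

open MeasureTheory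
open scoped RealInnerProductSpace Classical

/-- The δ-GClip step size `h(g) = η · min {1, max {δ, γ/‖g‖}}`, with the convention
that it equals `η` when `g = 0`. -/
noncomputable def deltaGClipStep {m : ℕ} (η γ δ : ℝ) (g : EuclideanSpace ℝ (Fin m)) : ℝ :=
  if g = 0 then η else η * min 1 (max δ (γ / ‖g‖))

theorem deltaGClipStep_le {m : ℕ} {η γ δ : ℝ} (hη : 0 ≤ η) (g : EuclideanSpace ℝ (Fin m)) :
    deltaGClipStep η γ δ g ≤ η := by
  unfold deltaGClipStep
  split_ifs
  · exact le_rfl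
  · exact mul_le_of_le_one_right hη (min_le_left _ _)

theorem mul_le_deltaGClipStep {m : ℕ} {η γ δ : ℝ} (hη : 0 ≤ η) (hδ : δ ≤ 1)
    (g : EuclideanSpace ℝ (Fin m)) : η * δ ≤ deltaGClipStep η γ δ g := by
  unfold deltaGClipStep
  split_ifs
  · exact mul_le_of_le_one_right hη hδ
  · exact mul_le_mul_of_nonneg_left (le_min hδ (le_max_left _ _)) hη

theorem measurable_deltaGClipStep {m : ℕ} (η γ δ : ℝ) :
    Measurable (deltaGClipStep (m := m) η γ δ) := by
  unfold deltaGClipStep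
  exact Measurable.ite (measurableSet_singleton 0) measurable_const (by fun_prop)

/-- The clipped step is at most `η` times the norm of the gradient estimate. -/
theorem norm_deltaGClipStep_smul_le {m : ℕ} {η γ δ : ℝ} (hη : 0 ≤ η) (hδ0 : 0 ≤ δ) (hδ1 : δ ≤ 1)
    (g : EuclideanSpace ℝ (Fin m)) : ‖deltaGClipStep η γ δ g • g‖ ≤ η * ‖g‖ := by
  have h0 : 0 ≤ deltaGClipStep η γ δ g :=
    (mul_nonneg hη hδ0).trans (mul_le_deltaGClipStep hη hδ1 g)
  rw [norm_smul, Real.norm_of_nonneg h0]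
  exact mul_le_mul_of_nonneg_right (deltaGClipStep_le hη g) (norm_nonneg g)

/-- Pointwise form of the descent estimate, before taking expectations. -/
theorem deltaGClip_descent_pointwise {m : ℕ} {L : EuclideanSpace ℝ (Fin m) → ℝ}
    {β θ η γ δ : ℝ} (hβ : 0 ≤ β) (hη : 0 ≤ η) (hδ0 : 0 ≤ δ) (hδ1 : δ ≤ 1)
    (hsmooth : ∀ x y, L y ≤ L x + ⟪gradient L x, y - x⟫ + β / 2 * ‖y - x‖ ^ 2)
    (w g : EuclideanSpace ℝ (Fin m)) (hg : ‖g - gradient L w‖ ≤ θ) :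
    L (w - deltaGClipStep η γ δ g • g) ≤
      L w - η * δ * ⟪gradient L w, g⟫ + η * (1 - δ) * θ * ‖gradient L w‖
        + β / 2 * (η * (‖gradient L w‖ + θ)) ^ 2 := by
  have hL := hsmooth w (w - deltaGClipStep η γ δ g • g)
  have hle := deltaGClipStep_le (γ := γ) (δ := δ) hη g
  have hge := mul_le_deltaGClipStep (γ := γ) hη hδ1 g
  have hstep := norm_deltaGClipStep_smul_le (γ := γ) hη hδ0 hδ1 g
  rw [sub_sub_cancel_left, norm_neg, inner_neg_right, real_inner_smul_right] at hL
  set G := gradient L w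
  set h := deltaGClipStep η γ δ g
  have hnorm : ‖g‖ ≤ ‖G‖ + θ := by
    linarith [norm_le_norm_add_norm_sub' g G]
  have hsq : ‖h • g‖ ^ 2 ≤ (η * (‖G‖ + θ)) ^ 2 :=
    pow_le_pow_left₀ (norm_nonneg _)
      (hstep.trans (mul_le_mul_of_nonneg_left hnorm hη)) 2
  have hinner : -(θ * ‖G‖) ≤ ⟪G, g⟫ := by
    have h1 : ⟪G, g⟫ = ‖G‖ ^ 2 + ⟪G, g - G⟫ := by
      rw [inner_sub_right, real_inner_self_eq_norm_sq]; ring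
    have h2 := neg_le_of_abs_le (abs_real_inner_le_norm G (g - G))
    have h3 := mul_le_mul_of_nonneg_left hg (norm_nonneg G)
    nlinarith [sq_nonneg ‖G‖]
  have hθG : 0 ≤ θ * ‖G‖ := mul_nonneg ((norm_nonneg _).trans hg) (norm_nonneg G)
  have h4 := mul_le_mul_of_nonneg_left hinner (sub_nonneg.2 hge)
  have h5 := mul_le_mul_of_nonneg_right (sub_le_sub_right hle (η * δ)) hθG
  have h6 := mul_le_mul_of_nonneg_left hsq (div_nonneg hβ zero_le_two)
  linarith

/-- The loss after one clipped step is integrable when the gradient noise is bounded. -/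
theorem integrable_comp_deltaGClip {m : ℕ} {Ω : Type*} {mΩ : MeasurableSpace Ω}
    {P : Measure Ω} [IsFiniteMeasure P] {L : EuclideanSpace ℝ (Fin m) → ℝ} {R η γ δ : ℝ}
    (hη : 0 ≤ η) (hδ0 : 0 ≤ δ) (hδ1 : δ ≤ 1) (hL : Continuous L)
    (w : EuclideanSpace ℝ (Fin m)) {g : Ω → EuclideanSpace ℝ (Fin m)}
    (hg : AEStronglyMeasurable g P) (hgb : ∀ᵐ ω ∂P, ‖g ω‖ ≤ R) :
    Integrable (fun ω => L (w - deltaGClipStep η γ δ (g ω) • g ω)) P := by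
  obtain ⟨C, hC⟩ := (isCompact_closedBall w (η * R)).exists_bound_of_continuousOn hL.continuousOn
  have hmeas : Measurable fun x => w - deltaGClipStep η γ δ x • x :=
    measurable_const.sub ((measurable_deltaGClipStep η γ δ).smul measurable_id)
  refine Integrable.of_bound
    ((hL.measurable.comp hmeas).comp_aemeasurable hg.aemeasurable).aestronglyMeasurable C ?_
  filter_upwards [hgb] with ω hω
  refine hC _ ?_
  rw [mem_closedBall_iff_norm, sub_sub_cancel_left, norm_neg]
  exact (norm_deltaGClipStep_smul_le hη hδ0 hδ1 _).trans (mul_le_mul_of_nonneg_left hω hη)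

/-- one-step descent estimate for stochastic δ-GClip.  If `L` is differentiable
and β-smooth, `g` is an integrable random vector with `E[g] = ∇L(w)` and
`‖g − ∇L(w)‖ ≤ θ` almost surely, and `w' = w − h(g) • g` with the δ-GClip step size, then
`E[L(w')] ≤ L(w) + (η(1−δ)θ + βη²θ)‖∇L(w)‖ − (ηδ − βη²/2)‖∇L(w)‖² + βη²θ²/2`. -/
theorem stochastic_deltaGClip_one_step_descent {m : ℕ}
    {Ω : Type*} {mΩ : MeasurableSpace Ω} (P : Measure Ω) [IsProbabilityMeasure P]
    (L : EuclideanSpace ℝ (Fin m) → ℝ) (β θ η γ δ : ℝ)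
    (hβ : 0 < β) (hθ : 0 < θ) (hη : 0 < η) (hγ : 0 < γ) (hδ0 : 0 < δ) (hδ1 : δ < 1)
    (hdiff : Differentiable ℝ L)
    (hsmooth : ∀ x y, L y ≤ L x + ⟪gradient L x, y - x⟫ + β / 2 * ‖y - x‖ ^ 2)
    (w : EuclideanSpace ℝ (Fin m))
    (g : Ω → EuclideanSpace ℝ (Fin m)) (hgint : Integrable g P)
    (hmean : ∫ ω, g ω ∂P = gradient L w)
    (hgb : ∀ᵐ ω ∂P, ‖g ω - gradient L w‖ ≤ θ) :
    ∫ ω, L (w - deltaGClipStep η γ δ (g ω) • g ω) ∂P ≤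
      L w + (η * (1 - δ) * θ + β * η ^ 2 * θ) * ‖gradient L w‖
        - (η * δ - β * η ^ 2 / 2) * ‖gradient L w‖ ^ 2 + β * η ^ 2 * θ ^ 2 / 2 := by
  have hR : ∀ᵐ ω ∂P, ‖g ω‖ ≤ ‖gradient L w‖ + θ := by
    filter_upwards [hgb] with ω hω
    linarith [norm_le_norm_add_norm_sub' (g ω) (gradient L w)]
  have hint := integrable_comp_deltaGClip (γ := γ) hη.le hδ0.le hδ1.le hdiff.continuous w
    hgint.aestronglyMeasurable hR
  have hinner : Integrable (fun ω => η * δ * ⟪gradient L w, g ω⟫) P :=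
    (hgint.const_inner (gradient L w)).const_mul (η * δ)
  set C := L w + η * (1 - δ) * θ * ‖gradient L w‖
    + β / 2 * (η * (‖gradient L w‖ + θ)) ^ 2 with hC
  calc ∫ ω, L (w - deltaGClipStep η γ δ (g ω) • g ω) ∂P
      ≤ ∫ ω, (C - η * δ * ⟪gradient L w, g ω⟫) ∂P := by
        refine integral_mono_ae hint ((integrable_const C).sub hinner) ?_
        filter_upwards [hgb] with ω hω
        linarith [deltaGClip_descent_pointwise (γ := γ) hβ.le hη.le hδ0.le hδ1.le hsmooth w
          (g ω) hω]
    _ = C - η * δ * ‖gradient L w‖ ^ 2 := by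
        rw [integral_sub (integrable_const C) hinner, integral_const_mul,
          integral_inner hgint, hmean, real_inner_self_eq_norm_sq]
        simp
    _ ≤ _ := by
        rw [hC]
        exact le_of_eq (by ring)
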